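/- Let d ≥ 1, γ̄¹ ∈ (0,1), and 0 ≤ γ̄² ≤ γ̄¹, and let η be a standard Gaussian random vector in ℝ^d. Then E[((1 − γ̄¹) + γ̄²‖η‖/√d)²] = (1 − γ̄¹ + γ̄²)² − 2(1 − γ̄¹)γ̄²(1 − √(2/d)·Γ((d+1)/2)/Γ(d/2)), and this expectation is strictly less than 1. -/

import Mathlib

open MeasureTheory ProbabilityTheory Filter Topology

noncomputable section

/-- `Euc d` is the `d`-dimensional Euclidean space `ℝ^d`. -/
abbrev Euc (d : ℕ) := EuclideanSpace ℝ (Fin d)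

/-- The standard Gaussian measure `N_d(0, I_d)` on `ℝ^d`, the image of the product of `d`
standard real Gaussians. -/
def stdGaussian (d : ℕ) : Measure (Euc d) :=
  (Measure.pi fun _ : Fin d => gaussianReal 0 1).map (EuclideanSpace.equiv (Fin d) ℝ).symm


lemma pi_gauss_density (d : ℕ) :
    (Measure.pi fun _ : Fin d => gaussianReal 0 1) =
      (volume : Measure (Fin d → ℝ)).withDensity
        (fun x => ENNReal.ofReal (∏ i, gaussianPDFReal 0 1 (x i))) := by
  refine Measure.pi_eq (fun s hs => ?_)
  rw [withDensity_apply _ (MeasurableSet.univ_pi hs), volume_pi, Measure.restrict_pi_pi]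
  have hint : ∀ i, Integrable (gaussianPDFReal 0 1) ((volume : Measure ℝ).restrict (s i)) :=
    fun i => (integrable_gaussianPDFReal 0 1).restrict
  rw [← ofReal_integral_eq_lintegral_ofReal]
  · rw [integral_fintype_prod_eq_prod (𝕜 := ℝ) (fun _ : Fin d => gaussianPDFReal 0 1),
      ENNReal.ofReal_prod_of_nonneg]
    · refine Finset.prod_congr rfl fun i _ => ?_
      rw [gaussianReal_apply_eq_integral _ one_ne_zero]
    · intro i _
      exact integral_nonneg fun x => gaussianPDFReal_nonneg _ _ _
  · exact Integrable.fintype_prod hint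
  · exact Filter.Eventually.of_forall fun x =>
      Finset.prod_nonneg fun i _ => gaussianPDFReal_nonneg _ _ _

def gc (d : ℕ) : ℝ := ((Real.sqrt (2 * Real.pi))⁻¹) ^ d

lemma std_density (d : ℕ) :
    _root_.stdGaussian d = (volume : Measure (Euc d)).withDensity
        (fun x => ENNReal.ofReal (gc d * Real.exp (-(1/2) * ‖x‖ ^ 2))) := by
  have hprod : ∀ x : Fin d → ℝ, ∏ i, gaussianPDFReal 0 1 (x i) =
      gc d * Real.exp (-(1/2) * ‖(WithLp.toLp 2 x : Euc d)‖ ^ 2) := by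
    intro x
    simp only [gaussianPDFReal, gc, EuclideanSpace.norm_sq_eq, Finset.prod_mul_distrib,
      ← Real.exp_sum, Finset.mul_sum]
    simp only [NNReal.coe_one, mul_one, Finset.prod_const, Finset.card_univ, Fintype.card_fin,
      sub_zero, Real.norm_eq_abs, sq_abs]
    congr 2
    exact Finset.sum_congr rfl fun i _ => by ring
  ext s hs
  have hmp := PiLp.volume_preserving_toLp (Fin d)
  have hm : Measurable (WithLp.toLp 2 : (Fin d → ℝ) → Euc d) := hmp.measurable
  have e : ((EuclideanSpace.equiv (Fin d) ℝ).symm : (Fin d → ℝ) → Euc d) = WithLp.toLp 2 := rfl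
  rw [_root_.stdGaussian, e, Measure.map_apply hm hs, pi_gauss_density,
    withDensity_apply _ (hm hs), withDensity_apply _ hs, ← hmp.map_eq,
    setLIntegral_map hs (by fun_prop) hm]
  simp_rw [hprod]

lemma std_prob (d : ℕ) : IsProbabilityMeasure (_root_.stdGaussian d) := by
  unfold _root_.stdGaussian
  exact Measure.isProbabilityMeasure_map (by fun_prop)

lemma gc_pos (d : ℕ) : 0 < gc d := by unfold gc; positivity

lemma std_moment_int (d : ℕ) (k : ℕ) :
    Integrable (fun x : Euc d => ‖x‖ ^ k) (_root_.stdGaussian d) := by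
  have : IsGaussian (_root_.stdGaussian d) := by
    have := map_pi_eq_stdGaussian (ι := Fin d)
    have h2 : _root_.stdGaussian d = ProbabilityTheory.stdGaussian (EuclideanSpace ℝ (Fin d)) := by
      rw [← this]; rfl
    rw [h2]; infer_instance
  rcases Nat.eq_zero_or_pos k with rfl | hk
  · have := std_prob d
    simp
  · exact (IsGaussian.memLp_id (_root_.stdGaussian d) k (by simp)).integrable_norm_pow hk.ne'

lemma std_moment (d : ℕ) (hd : 1 ≤ d) (k : ℕ) :
    ∫ x, ‖x‖ ^ k ∂(_root_.stdGaussian d) =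
      gc d * (d * (volume : Measure (Euc d)).real (Metric.ball 0 1)) *
       ((1/2:ℝ) ^ (-((d + k : ℝ) / 2)) * (1/2) * Real.Gamma ((d + k) / 2)) := by
  have : Nonempty (Fin d) := ⟨⟨0, hd⟩⟩
  rw [std_density, integral_withDensity_eq_integral_toReal_smul (by fun_prop) (by simp)]
  have h1 : ∀ x : Euc d, (ENNReal.ofReal (gc d * Real.exp (-(1/2) * ‖x‖ ^ 2))).toReal • ‖x‖ ^ k
     = (fun y : ℝ => gc d * Real.exp (-(1/2) * y ^ 2) * y ^ k) ‖x‖ := by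
    intro x
    have := gc_pos d
    rw [ENNReal.toReal_ofReal (by positivity), smul_eq_mul]
  rw [integral_congr_ae (Filter.Eventually.of_forall h1),
    integral_fun_norm_addHaar volume (fun y : ℝ => gc d * Real.exp (-(1/2) * y ^ 2) * y ^ k)]
  have h2 := integral_rpow_mul_exp_neg_mul_rpow (p := 2) (q := d + k - 1) (b := 1/2) two_pos
    (by have : (1:ℝ) ≤ d := by exact_mod_cast hd
        have : (0:ℝ) ≤ k := by positivity
        linarith) (by norm_num)
  have h3 : ∫ y in Set.Ioi (0:ℝ), y ^ (Module.finrank ℝ (Euc d) - 1) •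
      (gc d * Real.exp (-(1/2) * y ^ 2) * y ^ k) =
      gc d * ∫ x in Set.Ioi (0 : ℝ), x ^ (d + k - 1 : ℝ) * Real.exp (-(1/2) * x ^ (2:ℝ)) := by
    rw [← integral_const_mul]
    refine setIntegral_congr_fun measurableSet_Ioi fun y hy => ?_
    have : (d + k - 1 : ℝ) = ((d - 1 + k : ℕ) : ℝ) := by
      push_cast [Nat.cast_sub hd]; ring
    simp only [finrank_euclideanSpace, Fintype.card_fin, smul_eq_mul]
    rw [this, Real.rpow_natCast, pow_add, Real.rpow_two]
    ring
  rw [h3, h2]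
  simp only [finrank_euclideanSpace, Fintype.card_fin, smul_eq_mul, nsmul_eq_mul]
  rw [show -((d:ℝ) + k - 1 + 1) / 2 = -((d + k : ℝ) / 2) by ring,
    show ((d:ℝ) + k - 1 + 1) / 2 = ((d + k : ℝ) / 2) by ring]
  ring

lemma std_norm (d : ℕ) (hd : 1 ≤ d) :
    ∫ x, ‖x‖ ∂(_root_.stdGaussian d) =
      Real.sqrt 2 * Real.Gamma (((d : ℝ) + 1) / 2) / Real.Gamma ((d : ℝ) / 2) ∧
    ∫ x, ‖x‖ ^ 2 ∂(_root_.stdGaussian d) = d := by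
  have := std_prob d
  have hd' : (0:ℝ) < d := by exact_mod_cast hd
  have h0 := std_moment d hd 0
  have h1 := std_moment d hd 1
  have h2 := std_moment d hd 2
  have hG : 0 < Real.Gamma ((d:ℝ)/2) := Real.Gamma_pos_of_pos (by positivity)
  simp only [pow_zero, integral_const, probReal_univ, smul_eq_mul, mul_one, Nat.cast_zero,
    add_zero] at h0
  simp only [pow_one, Nat.cast_one] at h1
  set A := gc d * (d * (volume : Measure (Euc d)).real (Metric.ball 0 1))
  have e1 : (1/2:ℝ) ^ (-((d + 1 : ℝ) / 2)) = (1/2:ℝ) ^ (-((d : ℝ) / 2)) * Real.sqrt 2 := by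
    rw [show -((d + 1 : ℝ) / 2) = -((d : ℝ) / 2) + -(1/2) by ring, Real.rpow_add (by norm_num)]
    congr 1
    rw [Real.rpow_neg (by norm_num), ← Real.sqrt_eq_rpow, ← Real.sqrt_inv]; norm_num
  have e2 : (1/2:ℝ) ^ (-((d + 2 : ℝ) / 2)) = (1/2:ℝ) ^ (-((d : ℝ) / 2)) * 2 := by
    rw [show -((d + 2 : ℝ) / 2) = -((d : ℝ) / 2) + -1 by ring, Real.rpow_add (by norm_num)]
    congr 1
    rw [Real.rpow_neg (by norm_num)]; norm_num
  constructor
  · rw [h1, e1, eq_div_iff hG.ne']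
    linear_combination (-(Real.sqrt 2 * Real.Gamma ((d + 1) / 2))) * h0
  · rw [h2]
    push_cast
    rw [e2, show ((d:ℝ) + 2) / 2 = d / 2 + 1 by ring, Real.Gamma_add_one (by positivity)]
    linear_combination (-d : ℝ) * h0

lemma std_norm_lt (d : ℕ) (hd : 1 ≤ d) :
    ∫ x, ‖x‖ ∂(_root_.stdGaussian d) < Real.sqrt d := by
  have := std_prob d
  have hd' : (0:ℝ) < d := by exact_mod_cast hd
  have : Nonempty (Fin d) := ⟨⟨0, hd⟩⟩
  by_contra! hcon
  have i1 := std_moment_int d 1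
  have i2 := std_moment_int d 2
  simp only [pow_one] at i1
  have hs : Real.sqrt d ^ 2 = d := Real.sq_sqrt hd'.le
  have hsp : 0 < Real.sqrt d := Real.sqrt_pos.2 hd'
  have hexp : ∀ x : Euc d, (‖x‖ - Real.sqrt d) ^ 2 = ‖x‖ ^ 2 - 2 * Real.sqrt d * ‖x‖ + d := by
    intro x; linear_combination hs
  have iI : Integrable (fun x : Euc d => (‖x‖ - Real.sqrt d) ^ 2) (_root_.stdGaussian d) := by
    simp_rw [hexp]
    exact (i2.sub (i1.const_mul _)).add (integrable_const _)
  have hI : ∫ x, (‖x‖ - Real.sqrt d) ^ 2 ∂(_root_.stdGaussian d) ≤ 0 := by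
    simp_rw [hexp]
    rw [integral_add (f := fun x : Euc d => ‖x‖ ^ 2 - 2 * Real.sqrt d * ‖x‖)
        (i2.sub (i1.const_mul _)) (integrable_const _),
      integral_sub i2 (i1.const_mul _), integral_const_mul, (std_norm d hd).2]
    simp only [integral_const, probReal_univ, smul_eq_mul, one_mul]
    nlinarith
  have h0 := (integral_eq_zero_iff_of_nonneg (fun x => sq_nonneg _) iI).1
    (le_antisymm hI (integral_nonneg fun x => sq_nonneg _))
  have hac : _root_.stdGaussian d ≪ volume := by
    rw [std_density]; exact withDensity_absolutelyContinuous _ _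
  have hz : _root_.stdGaussian d (Metric.sphere 0 (Real.sqrt d)) = 0 :=
    hac (Measure.addHaar_sphere_of_ne_zero volume 0 hsp.ne')
  have hz' : ∀ᵐ x ∂(_root_.stdGaussian d), x ∉ Metric.sphere (0 : Euc d) (Real.sqrt d) :=
    measure_eq_zero_iff_ae_notMem.1 hz
  obtain ⟨x, hx, hx'⟩ := (h0.and hz').exists
  apply hx'
  simp only [Pi.zero_apply] at hx
  have := pow_eq_zero_iff (two_ne_zero) |>.1 hx
  simp only [mem_sphere_iff_norm, sub_zero]
  linarith

/-- For `d ≥ 1`, `γ̄¹ ∈ (0,1)`, `0 ≤ γ̄² ≤ γ̄¹`, and a standard Gaussian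
vector `η` in `ℝ^d`, the squared isotropic contraction factor satisfies
`E[((1 − γ̄¹) + γ̄²‖η‖/√d)²] = (1 − γ̄¹ + γ̄²)² − 2(1 − γ̄¹)γ̄²(1 − √(2/d)·Γ((d+1)/2)/Γ(d/2))`,
and this expectation is strictly less than `1`. -/
theorem isotropic_contraction_factor
    {Ω : Type*} [MeasurableSpace Ω] (P : Measure Ω) [IsProbabilityMeasure P]
    {d : ℕ} (hd : 1 ≤ d)
    (γb1 γb2 : ℝ) (hγb1 : γb1 ∈ Set.Ioo (0:ℝ) 1) (hγb2 : 0 ≤ γb2) (hle : γb2 ≤ γb1)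
    (η : Ω → Euc d) (hη : Measurable η)
    (hdist : Measure.map η P = stdGaussian d) :
    (∫ ω, ((1 - γb1) + γb2 * ‖η ω‖ / Real.sqrt d) ^ 2 ∂P =
      (1 - γb1 + γb2) ^ 2 -
        2 * (1 - γb1) * γb2 *
          (1 - Real.sqrt (2 / d) * Real.Gamma (((d : ℝ) + 1) / 2) / Real.Gamma ((d : ℝ) / 2))) ∧
    ∫ ω, ((1 - γb1) + γb2 * ‖η ω‖ / Real.sqrt d) ^ 2 ∂P < 1 := by
  have := std_prob d
  have hd' : (0:ℝ) < d := by exact_mod_cast hd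
  have hs : Real.sqrt d ^ 2 = d := Real.sq_sqrt hd'.le
  have hsp : 0 < Real.sqrt d := Real.sqrt_pos.2 hd'
  have i1 := std_moment_int d 1
  have i2 := std_moment_int d 2
  simp only [pow_one] at i1
  have key : ∫ ω, ((1 - γb1) + γb2 * ‖η ω‖ / Real.sqrt d) ^ 2 ∂P =
      (1 - γb1) ^ 2 + 2 * (1 - γb1) * γb2 * ((∫ x, ‖x‖ ∂(_root_.stdGaussian d)) / Real.sqrt d)
        + γb2 ^ 2 := by
    have e : ∫ ω, ((1 - γb1) + γb2 * ‖η ω‖ / Real.sqrt d) ^ 2 ∂P =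
        ∫ x, ((1 - γb1) + γb2 * ‖x‖ / Real.sqrt d) ^ 2 ∂(_root_.stdGaussian d) := by
      rw [← hdist, integral_map hη.aemeasurable (by fun_prop)]
    have hexp : ∀ x : Euc d, ((1 - γb1) + γb2 * ‖x‖ / Real.sqrt d) ^ 2 =
        γb2 ^ 2 / d * ‖x‖ ^ 2 + 2 * (1 - γb1) * γb2 / Real.sqrt d * ‖x‖ + (1 - γb1) ^ 2 := by
      intro x
      rw [← hs, Real.sqrt_sq hsp.le]; field_simp; ring
    rw [e]
    simp_rw [hexp]
    rw [integral_add (f := fun x : Euc d =>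
          γb2 ^ 2 / d * ‖x‖ ^ 2 + 2 * (1 - γb1) * γb2 / Real.sqrt d * ‖x‖)
        ((i2.const_mul _).add (i1.const_mul _)) (integrable_const _),
      integral_add (i2.const_mul _) (i1.const_mul _), integral_const_mul, integral_const_mul,
      (std_norm d hd).2]
    simp only [integral_const, probReal_univ, smul_eq_mul, one_mul]
    field_simp
    ring
  constructor
  · rw [key, (std_norm d hd).1, Real.sqrt_div (by norm_num)]
    field_simp
    ring
  · rw [key]
    have hm : (∫ x, ‖x‖ ∂(_root_.stdGaussian d)) / Real.sqrt d < 1 :=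
      (div_lt_one hsp).2 (std_norm_lt d hd)
    obtain ⟨h1, h2⟩ := hγb1
    generalize (∫ x, ‖x‖ ∂(_root_.stdGaussian d)) / Real.sqrt d = m at hm
    rcases hγb2.eq_or_lt with h | h
    · subst h; nlinarith
    · have : 0 < (1 - γb1) * γb2 := mul_pos (by linarith) h
      nlinarith [mul_pos this (sub_pos.2 hm)]
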